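/- arXiv:1810.08278 — 5 statements merged into one kernel-verified Lean document; each statement's English description precedes it below -/
import Mathlib

section
/- The entropic transport cost OT_ε is weakly continuous on pairs of Borel probability measures on X: if α_n ⇀ α and β_n ⇀ β are weakly converging sequences of Borel probability measures on X, then OT_ε(α_n, β_n) → OT_ε(α, β). -/
open MeasureTheory Real Filter Topology
open scoped NNReal ENNReal

/-- The entropic dual functional `D_ε(α, β; f, g)`. -/
noncomputable def Dfun {X : Type*} [MeasurableSpace X] (eps : ℝ) (C : X → X → ℝ)
    (alpha beta : Measure X) (f g : X → ℝ) : ℝ :=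
  (∫ x, f x ∂alpha) + (∫ y, g y ∂beta) -
    eps * ∫ x, ∫ y, (Real.exp ((f x + g y - C x y) / eps) - 1) ∂beta ∂alpha

/-- The entropic transport cost `OT_ε(α, β)`, as a supremum of the dual
functional over pairs of continuous potentials. -/
noncomputable def OTcost {X : Type*} [TopologicalSpace X] [MeasurableSpace X] (eps : ℝ) (C : X → X → ℝ)
    (alpha beta : Measure X) : ℝ :=
  sSup {r : ℝ | ∃ f g : X → ℝ, Continuous f ∧ Continuous g ∧ r = Dfun eps C alpha beta f g}

/-- A continuous function on a compact space is integrable for any finite Borel measure. -/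
theorem Continuous.integrable_of_compactSpace {Y : Type*} [TopologicalSpace Y] [CompactSpace Y]
    [MeasurableSpace Y] [OpensMeasurableSpace Y] {μ : Measure Y} [IsFiniteMeasure μ] {f : Y → ℝ}
    (hf : Continuous f) : Integrable f μ :=
  (BoundedContinuousFunction.mkOfCompact ⟨f, hf⟩).integrable μ

theorem continuous_integral_probabilityMeasure {Y : Type*} [TopologicalSpace Y] [CompactSpace Y]
    [MeasurableSpace Y] [OpensMeasurableSpace Y] :
    Continuous fun p : ProbabilityMeasure Y × C(Y, ℝ) => ∫ y, p.2 y ∂(p.1 : Measure Y) := by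
  refine continuous_prod_of_continuous_lipschitzWith' _ 1 (fun μ => ?_) (fun h => ?_)
  · refine LipschitzWith.of_dist_le_mul fun h h' => ?_
    rw [Real.dist_eq, ← integral_sub h.continuous.integrable_of_compactSpace
      h'.continuous.integrable_of_compactSpace, ← Real.norm_eq_abs]
    refine (norm_integral_le_of_norm_le_const (C := dist h h')
      (.of_forall fun y => ?_)).trans ?_
    · rw [← dist_eq_norm]
      exact ContinuousMap.dist_apply_le_dist y
    · simp
  · refine continuous_iff_continuousAt.2 fun μ => ?_
    exact ProbabilityMeasure.tendsto_iff_forall_integral_tendsto.1 tendsto_id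
      (BoundedContinuousFunction.mkOfCompact h)

theorem continuous_uncurry_of_lipschitzWith {X : Type*} [PseudoMetricSpace X] {C : X → X → ℝ}
    {κ : ℝ≥0} (h1 : ∀ y, LipschitzWith κ fun x => C x y) (h2 : ∀ x, LipschitzWith κ (C x)) :
    Continuous fun p : X × X => C p.1 p.2 :=
  (LipschitzWith.uncurry h1 h2).continuous

theorem isCompact_lipschitzWith_bounded (X : Type*) [PseudoMetricSpace X] [CompactSpace X]
    (κ : ℝ≥0) (R : ℝ) :
    IsCompact {f : C(X, ℝ) | LipschitzWith κ f ∧ ∀ x, |f x| ≤ R} := by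
  have key : IsCompact {f : BoundedContinuousFunction X ℝ |
      LipschitzWith κ f ∧ ∀ x, |f x| ≤ R} := by
    refine BoundedContinuousFunction.arzela_ascoli₂ (Set.Icc (-R) R) isCompact_Icc _ ?_
      (fun f x hf => abs_le.1 (hf.2 x)) ?_
    · simp only [lipschitzWith_iff_dist_le_mul, Set.ofPred_and, Set.ofPred_forall]
      refine .inter (isClosed_iInter fun x => isClosed_iInter fun y => ?_)
        (isClosed_iInter fun x => ?_)
      · exact isClosed_le (by fun_prop) continuous_const
      · exact isClosed_le (by fun_prop) continuous_const
    · exact (LipschitzWith.uniformEquicontinuous _ κ fun f => f.2.1).equicontinuous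
  have h_eq : {f : C(X, ℝ) | LipschitzWith κ f ∧ ∀ x, |f x| ≤ R} =
      (ContinuousMap.isometryEquivBoundedOfCompact X ℝ).symm ''
        {f : BoundedContinuousFunction X ℝ | LipschitzWith κ f ∧ ∀ x, |f x| ≤ R} := by
    ext f
    constructor
    · intro hf
      exact ⟨BoundedContinuousFunction.mkOfCompact f, hf, by ext; rfl⟩
    · rintro ⟨g, hg, rfl⟩
      exact hg
  rw [h_eq]
  exact key.image (ContinuousMap.isometryEquivBoundedOfCompact X ℝ).symm.continuous

section Dual

variable {X : Type*} [MeasurableSpace X] {eps : ℝ} {C : X → X → ℝ}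

theorem Dfun_shift (alpha beta : Measure X) [IsProbabilityMeasure alpha]
    [IsProbabilityMeasure beta] {f g : X → ℝ} (hf : Integrable f alpha) (hg : Integrable g beta)
    (c : ℝ) :
    Dfun eps C alpha beta (fun x => f x - c) (fun y => g y + c) = Dfun eps C alpha beta f g := by
  have h : ∀ x y, f x - c + (g y + c) - C x y = f x + g y - C x y := fun x y => by ring
  simp only [Dfun, h]
  rw [integral_sub hf (integrable_const c), integral_add hg (integrable_const c)]
  simp

/-- The soft `C`-transform of `g` with respect to `beta`. -/
noncomputable def softTransform (eps : ℝ) (C : X → X → ℝ) (beta : Measure X) (g : X → ℝ) (x : X) :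
    ℝ :=
  -eps * Real.log (∫ y, Real.exp ((g y - C x y) / eps) ∂beta)

variable [TopologicalSpace X] [CompactSpace X] [OpensMeasurableSpace X]

theorem integral_exp_softTransform_pos
    (hC : ∀ x, Continuous (C x)) (beta : Measure X) [IsProbabilityMeasure beta] {g : X → ℝ}
    (hg : Continuous g) (x : X) : 0 < ∫ y, Real.exp ((g y - C x y) / eps) ∂beta := by
  have := hC x
  exact integral_exp_pos (Continuous.integrable_of_compactSpace (by fun_prop))

theorem integral_exp_eq_exp_softTransform (heps : 0 < eps) (hC : ∀ x, Continuous (C x))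
    (beta : Measure X) [IsProbabilityMeasure beta] {g : X → ℝ} (hg : Continuous g)
    (f : X → ℝ) (x : X) :
    ∫ y, (Real.exp ((f x + g y - C x y) / eps) - 1) ∂beta =
      Real.exp ((f x - softTransform eps C beta g x) / eps) - 1 := by
  have hCx := hC x
  have hpos := integral_exp_softTransform_pos (eps := eps) hC beta hg x
  rw [integral_sub (Continuous.integrable_of_compactSpace (by fun_prop)) (integrable_const _)]
  have h : ∀ y, Real.exp ((f x + g y - C x y) / eps) =
      Real.exp (f x / eps) * Real.exp ((g y - C x y) / eps) := fun y => by
    rw [← Real.exp_add]; congr 1; ring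
  have h' : (f x - softTransform eps C beta g x) / eps =
      f x / eps + Real.log (∫ y, Real.exp ((g y - C x y) / eps) ∂beta) := by
    rw [softTransform]; field_simp; ring
  simp only [h, integral_const_mul, h']
  rw [Real.exp_add, Real.exp_log hpos]
  simp

theorem Dfun_le_softTransform (heps : 0 < eps) (hC : ∀ x, Continuous (C x))
    (alpha beta : Measure X) [IsProbabilityMeasure alpha]
    [IsProbabilityMeasure beta] {f g : X → ℝ} (hf : Continuous f) (hg : Continuous g)
    (hS : Continuous (softTransform eps C beta g)) :
    Dfun eps C alpha beta f g ≤ Dfun eps C alpha beta (softTransform eps C beta g) g := by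
  simp only [Dfun, integral_exp_eq_exp_softTransform heps hC beta hg, sub_self, zero_div,
    Real.exp_zero, integral_zero, mul_zero, sub_zero]
  have hle : ∫ x, f x ∂alpha ≤ ∫ x, (softTransform eps C beta g x +
      eps * (Real.exp ((f x - softTransform eps C beta g x) / eps) - 1)) ∂alpha := by
    refine integral_mono hf.integrable_of_compactSpace
      (Continuous.integrable_of_compactSpace (by fun_prop)) fun x => ?_
    have h := Real.add_one_le_exp ((f x - softTransform eps C beta g x) / eps)
    have h' := mul_le_mul_of_nonneg_left h heps.le
    rw [mul_add, mul_div_cancel₀ _ heps.ne'] at h'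
    dsimp only
    linarith
  rw [integral_add hS.integrable_of_compactSpace
    (Continuous.integrable_of_compactSpace (by fun_prop)), integral_const_mul] at hle
  linarith

theorem abs_softTransform_le (heps : 0 < eps) (hC : ∀ x, Continuous (C x))
    (beta : Measure X) [IsProbabilityMeasure beta] {g : X → ℝ} (hg : Continuous g) {B M : ℝ}
    (hB : ∀ y, |g y| ≤ B) (hM : ∀ x y, |C x y| ≤ M) (x : X) :
    |softTransform eps C beta g x| ≤ B + M := by
  have hCx := hC x
  have hpos := integral_exp_softTransform_pos (eps := eps) hC beta hg x
  have hint : Integrable (fun y => Real.exp ((g y - C x y) / eps)) beta :=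
    Continuous.integrable_of_compactSpace (by fun_prop)
  have hupper : ∫ y, Real.exp ((g y - C x y) / eps) ∂beta ≤ Real.exp ((B + M) / eps) := by
    refine (integral_mono hint (integrable_const (Real.exp ((B + M) / eps))) fun y => ?_).trans
      (by simp)
    have h1 := abs_le.1 (hB y)
    have h2 := abs_le.1 (hM x y)
    dsimp only
    gcongr
    linarith
  have hlower : Real.exp (-(B + M) / eps) ≤ ∫ y, Real.exp ((g y - C x y) / eps) ∂beta := by
    refine le_trans (by simp) (integral_mono (integrable_const (Real.exp (-(B + M) / eps))) hint
      fun y => ?_)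
    have h1 := abs_le.1 (hB y)
    have h2 := abs_le.1 (hM x y)
    dsimp only
    gcongr
    linarith
  rw [← Real.log_le_iff_le_exp hpos, le_div_iff₀ heps] at hupper
  rw [← Real.le_log_iff_exp_le hpos, div_le_iff₀ heps] at hlower
  rw [softTransform, abs_le]
  constructor <;> linarith

end Dual

theorem lipschitzWith_softTransform {X : Type*} [PseudoMetricSpace X] [CompactSpace X]
    [MeasurableSpace X] [OpensMeasurableSpace X] {eps : ℝ} (heps : 0 < eps) {C : X → X → ℝ}
    {κ : ℝ≥0} (h1 : ∀ y, LipschitzWith κ fun x => C x y) (hC : ∀ x, Continuous (C x))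
    (beta : Measure X) [IsProbabilityMeasure beta] {g : X → ℝ} (hg : Continuous g) :
    LipschitzWith κ (softTransform eps C beta g) := by
  refine LipschitzWith.of_le_add_mul κ fun x x' => ?_
  have hCx := hC x
  have hCx' := hC x'
  have hpos := integral_exp_softTransform_pos (eps := eps) hC beta hg x
  have hpos' := integral_exp_softTransform_pos (eps := eps) hC beta hg x'
  have hle : ∫ y, Real.exp ((g y - C x' y) / eps) ∂beta ≤
      Real.exp (κ * dist x x' / eps) * ∫ y, Real.exp ((g y - C x y) / eps) ∂beta := by
    rw [← integral_const_mul]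
    refine integral_mono (Continuous.integrable_of_compactSpace (by fun_prop))
      (Continuous.integrable_of_compactSpace (by fun_prop)) fun y => ?_
    have h := (abs_le.1 ((h1 y).dist_le_mul x x')).2
    dsimp only
    rw [← Real.exp_add, ← add_div]
    gcongr
    linarith
  have hlog := Real.log_le_log hpos' hle
  rw [Real.log_mul (Real.exp_pos _).ne' hpos.ne', Real.log_exp] at hlog
  have h := mul_le_mul_of_nonneg_left hlog heps.le
  rw [mul_add, mul_div_cancel₀ _ heps.ne'] at h
  simp only [softTransform]
  linarith

section Metric

variable {X : Type*} [MetricSpace X] [CompactSpace X] [MeasurableSpace X] [BorelSpace X]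
  {eps : ℝ} {C : X → X → ℝ} {κ : ℝ≥0}

theorem Dfun_swap (hCsym : ∀ x y, C x y = C y x) (hC : Continuous fun p : X × X => C p.1 p.2)
    (alpha beta : Measure X) [IsProbabilityMeasure alpha] [IsProbabilityMeasure beta]
    {f g : X → ℝ} (hf : Continuous f) (hg : Continuous g) :
    Dfun eps C alpha beta f g = Dfun eps C beta alpha g f := by
  have hswap := integral_integral_swap (μ := alpha) (ν := beta)
    (f := fun x y => Real.exp ((f x + g y - C x y) / eps) - 1)
    (Continuous.integrable_of_compactSpace (by unfold Function.uncurry; fun_prop))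
  have h : ∀ x y, g y + f x - C y x = f x + g y - C x y := fun x y => by
    rw [hCsym y x]; ring
  simp only [Dfun, hswap, h]
  ring

theorem exists_lipschitz_bounded_Dfun_le (heps : 0 < eps) (hCsym : ∀ x y, C x y = C y x)
    (h1 : ∀ y, LipschitzWith κ fun x => C x y) (h2 : ∀ x, LipschitzWith κ (C x))
    {M : ℝ} (hM : ∀ x y, |C x y| ≤ M)
    (alpha beta : Measure X) [IsProbabilityMeasure alpha] [IsProbabilityMeasure beta]
    {f g : X → ℝ} (hf : Continuous f) (hg : Continuous g) :
    ∃ f' g' : C(X, ℝ),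
      (LipschitzWith κ f' ∧ ∀ x, |f' x| ≤ κ * Metric.diam (Set.univ : Set X) + M) ∧
      (LipschitzWith κ g' ∧ ∀ x, |g' x| ≤ κ * Metric.diam (Set.univ : Set X) + M) ∧
      Dfun eps C alpha beta f g ≤ Dfun eps C alpha beta f' g' := by
  obtain ⟨x₀⟩ := nonempty_of_isProbabilityMeasure alpha
  have hC := continuous_uncurry_of_lipschitzWith h1 h2
  have hCx : ∀ x, Continuous (C x) := fun x => (h2 x).continuous
  have hM0 : 0 ≤ M := (abs_nonneg _).trans (hM x₀ x₀)
  have hS := lipschitzWith_softTransform heps h1 hCx beta hg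
  set S := softTransform eps C beta g
  have hF : LipschitzWith κ fun x => S x - S x₀ :=
    LipschitzWith.of_dist_le_mul fun x y => by simpa using hS.dist_le_mul x y
  have hFB : ∀ x, |S x - S x₀| ≤ κ * Metric.diam (Set.univ : Set X) := fun x =>
    (hS.dist_le_mul x x₀).trans (by
      gcongr
      exact Metric.dist_le_diam_of_mem isCompact_univ.isBounded (Set.mem_univ _) (Set.mem_univ _))
  have hG := lipschitzWith_softTransform heps h1 hCx alpha hF.continuous
  refine ⟨⟨_, hF.continuous⟩, ⟨_, hG.continuous⟩,
    ⟨hF, fun x => (hFB x).trans (le_add_of_nonneg_right hM0)⟩,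
    ⟨hG, abs_softTransform_le heps hCx alpha hF.continuous hFB hM⟩, ?_⟩
  have hg' : Continuous fun y => g y + S x₀ := by fun_prop
  calc Dfun eps C alpha beta f g
      ≤ Dfun eps C alpha beta S g :=
        Dfun_le_softTransform heps hCx alpha beta hf hg hS.continuous
    _ = Dfun eps C alpha beta (fun x => S x - S x₀) (fun y => g y + S x₀) :=
        (Dfun_shift alpha beta hS.continuous.integrable_of_compactSpace
          hg.integrable_of_compactSpace _).symm
    _ = Dfun eps C beta alpha (fun y => g y + S x₀) (fun x => S x - S x₀) :=
        Dfun_swap hCsym hC alpha beta hF.continuous hg'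
    _ ≤ Dfun eps C beta alpha (softTransform eps C alpha fun x => S x - S x₀)
          (fun x => S x - S x₀) :=
        Dfun_le_softTransform heps hCx beta alpha hg' hF.continuous hG.continuous
    _ = _ := Dfun_swap hCsym hC beta alpha hG.continuous hF.continuous

theorem continuous_Dfun (hC : Continuous fun p : X × X => C p.1 p.2) :
    Continuous fun p : (ProbabilityMeasure X × ProbabilityMeasure X) × (C(X, ℝ) × C(X, ℝ)) =>
      Dfun eps C (p.1.1 : Measure X) (p.1.2 : Measure X) p.2.1 p.2.2 := by
  let E : C(X, ℝ) × C(X, ℝ) → C(X × X, ℝ) := fun q =>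
    ⟨fun z => Real.exp ((q.1 z.1 + q.2 z.2 - C z.1 z.2) / eps) - 1, by fun_prop⟩
  have hE : Continuous E := by
    refine ContinuousMap.continuous_of_continuous_uncurry _ ?_
    have hC' : Continuous fun p : (C(X, ℝ) × C(X, ℝ)) × (X × X) => C p.2.1 p.2.2 :=
      hC.comp continuous_snd
    simp only [Function.uncurry_def, E, ContinuousMap.coe_mk]
    fun_prop
  have hprod : ∀ p : (ProbabilityMeasure X × ProbabilityMeasure X) × (C(X, ℝ) × C(X, ℝ)),
      ∫ x, ∫ y, (Real.exp ((p.2.1 x + p.2.2 y - C x y) / eps) - 1) ∂(p.1.2 : Measure X)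
        ∂(p.1.1 : Measure X) =
      ∫ z, E p.2 z ∂((p.1.1.prod p.1.2 : ProbabilityMeasure (X × X)) : Measure (X × X)) :=
    fun p => (integral_prod (μ := (p.1.1 : Measure X)) (ν := (p.1.2 : Measure X)) (E p.2)
      (E p.2).continuous.integrable_of_compactSpace).symm
  simp only [Dfun, hprod]
  refine ((?_ : Continuous _).add (?_ : Continuous _)).sub (continuous_const.mul ?_)
  · exact continuous_integral_probabilityMeasure.comp
      ((continuous_fst.comp continuous_fst).prodMk (continuous_fst.comp continuous_snd))
  · exact continuous_integral_probabilityMeasure.comp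
      ((continuous_snd.comp continuous_fst).prodMk (continuous_snd.comp continuous_snd))
  · exact continuous_integral_probabilityMeasure.comp
      ((ProbabilityMeasure.continuous_prod.comp continuous_fst).prodMk (hE.comp continuous_snd))

theorem continuous_OTcost (heps : 0 < eps) (hCsym : ∀ x y, C x y = C y x)
    (h1 : ∀ y, LipschitzWith κ fun x => C x y) (h2 : ∀ x, LipschitzWith κ (C x)) :
    Continuous fun p : ProbabilityMeasure X × ProbabilityMeasure X =>
      OTcost eps C (p.1 : Measure X) (p.2 : Measure X) := by
  have hC := continuous_uncurry_of_lipschitzWith h1 h2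
  obtain ⟨M, hM⟩ := isCompact_univ.exists_bound_of_continuousOn hC.continuousOn
  have hM' : ∀ x y, |C x y| ≤ M := fun x y => hM (x, y) (Set.mem_univ _)
  let L : Set C(X, ℝ) :=
    {f | LipschitzWith κ f ∧ ∀ x, |f x| ≤ κ * Metric.diam (Set.univ : Set X) + M}
  have hL : IsCompact L := isCompact_lipschitzWith_bounded X κ _
  let F : ProbabilityMeasure X × ProbabilityMeasure X → C(X, ℝ) × C(X, ℝ) → ℝ :=
    fun p q => Dfun eps C (p.1 : Measure X) (p.2 : Measure X) q.1 q.2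
  have hF : Continuous ↿F := continuous_Dfun hC
  convert (hL.prod hL).continuous_sSup hF using 2 with p
  have himp := fun {f g : X → ℝ} (hf : Continuous f) (hg : Continuous g) =>
    exists_lipschitz_bounded_Dfun_le heps hCsym h1 h2 hM' (p.1 : Measure X) (p.2 : Measure X) hf hg
  have hbdd : BddAbove (F p '' L ×ˢ L) :=
    ((hL.prod hL).image (hF.comp (Continuous.prodMk_right p))).bddAbove
  apply le_antisymm
  · refine csSup_le ⟨_, 0, 0, continuous_const, continuous_const, rfl⟩ ?_
    rintro _ ⟨f, g, hf, hg, rfl⟩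
    obtain ⟨f', g', hf', hg', hle⟩ := himp hf hg
    exact hle.trans (le_csSup hbdd ⟨(f', g'), ⟨hf', hg'⟩, rfl⟩)
  · obtain ⟨f₀, g₀, hf₀, hg₀, -⟩ := himp (continuous_const (y := 0)) (continuous_const (y := 0))
    refine csSup_le_csSup ?_ ⟨_, (f₀, g₀), ⟨hf₀, hg₀⟩, rfl⟩ ?_
    · obtain ⟨B, hB⟩ := hbdd
      refine ⟨B, ?_⟩
      rintro _ ⟨f, g, hf, hg, rfl⟩
      obtain ⟨f', g', hf', hg', hle⟩ := himp hf hg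
      exact hle.trans (hB ⟨(f', g'), ⟨hf', hg'⟩, rfl⟩)
    · rintro _ ⟨q, -, rfl⟩
      exact ⟨q.1, q.2, q.1.continuous, q.2.continuous, rfl⟩

end Metric

/-- The entropic transport cost `OT_ε` is weakly continuous on
pairs of Borel probability measures. -/
theorem OTcost_weakly_continuous
    {X : Type*} [MetricSpace X] [CompactSpace X] [MeasurableSpace X] [BorelSpace X]
    (eps : ℝ) (heps : 0 < eps) (C : X → X → ℝ) (kappa : ℝ≥0) (hkappa : 0 < kappa)
    (hCsym : ∀ x y, C x y = C y x)
    (hClip1 : ∀ y, LipschitzWith kappa (fun x => C x y))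
    (hClip2 : ∀ x, LipschitzWith kappa (fun y => C x y))
    (alphaSeq betaSeq : ℕ → Measure X) (alpha beta : Measure X)
    [∀ n, IsProbabilityMeasure (alphaSeq n)] [∀ n, IsProbabilityMeasure (betaSeq n)]
    [IsProbabilityMeasure alpha] [IsProbabilityMeasure beta]
    (halpha : ∀ f : X → ℝ, Continuous f →
      Tendsto (fun n => ∫ x, f x ∂(alphaSeq n)) atTop (𝓝 (∫ x, f x ∂alpha)))
    (hbeta : ∀ f : X → ℝ, Continuous f →
      Tendsto (fun n => ∫ x, f x ∂(betaSeq n)) atTop (𝓝 (∫ x, f x ∂beta))) :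
    Tendsto (fun n => OTcost eps C (alphaSeq n) (betaSeq n)) atTop
      (𝓝 (OTcost eps C alpha beta)) := by
  have ha : Tendsto (β := ProbabilityMeasure X) (fun n => ⟨alphaSeq n, inferInstance⟩) atTop
      (𝓝 ⟨alpha, inferInstance⟩) :=
    ProbabilityMeasure.tendsto_iff_forall_integral_tendsto.2 fun f => halpha f f.continuous
  have hb : Tendsto (β := ProbabilityMeasure X) (fun n => ⟨betaSeq n, inferInstance⟩) atTop
      (𝓝 ⟨beta, inferInstance⟩) :=
    ProbabilityMeasure.tendsto_iff_forall_integral_tendsto.2 fun f => hbeta f f.continuous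
  have h := (continuous_OTcost heps hCsym hClip1 hClip2).continuousAt.tendsto.comp
    (ha.prodMk_nhds hb)
  exact h
end

section
/- Assume the Gibbs kernel k_ε is strictly positive definite. Let α, β be Borel probability measures on X, and let p_α, p_β be continuous symmetric potentials, i.e. p_α = T_ε(α, p_α) and p_β = T_ε(β, p_β) on all of X. Then the Hausdorff divergence H_ε(α, β) = ½ ∫ (p_β − p_α) d(α − β) satisfies H_ε(α, β) ≥ 0, with equality if and only if α = β. -/
open MeasureTheory Real Filter Topology
open scoped NNReal ENNReal

/-- The squared kernel norm `‖ξ‖²_k = ∫∫ k dξ dξ` of the finite signed measure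
`ξ = μ - ν`, written out in terms of its positive and negative parts. -/
noncomputable def kerQuad {X : Type*} [MeasurableSpace X] (k : X → X → ℝ)
    (mu nu : Measure X) : ℝ :=
  ∫ x, ∫ y, k x y ∂mu ∂mu - ∫ x, ∫ y, k x y ∂nu ∂mu
    - ∫ x, ∫ y, k x y ∂mu ∂nu + ∫ x, ∫ y, k x y ∂nu ∂nu

/-- A kernel is strictly positive definite if `‖ξ‖²_k > 0` for every nonzero
finite signed Borel measure `ξ = μ - ν`. -/
def StrictPosDef {X : Type*} [MeasurableSpace X] (k : X → X → ℝ) : Prop :=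
  ∀ mu nu : Measure X, IsFiniteMeasure mu → IsFiniteMeasure nu → mu ≠ nu →
    0 < kerQuad k mu nu

/-- The Sinkhorn map `T_ε(α, f)(y) = -ε log ∫ exp((f(x) - C(x,y))/ε) dα(x)`. -/
noncomputable def Tmap {X : Type*} [MeasurableSpace X] (eps : ℝ) (C : X → X → ℝ)
    (alpha : Measure X) (f : X → ℝ) : X → ℝ :=
  fun y => -eps * Real.log (∫ x, Real.exp ((f x - C x y) / eps) ∂alpha)

/-- The measure with density `exp (p / ε)` with respect to `alpha`. -/
noncomputable def gibbsMeasure {X : Type*} [MeasurableSpace X] (eps : ℝ)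
    (alpha : Measure X) (p : X → ℝ) : Measure X :=
  alpha.withDensity fun x => ENNReal.ofReal (Real.exp (p x / eps))

section

variable {X : Type*} [MetricSpace X] [MeasurableSpace X] [BorelSpace X]

theorem integral_gibbsMeasure (eps : ℝ) (alpha : Measure X) {p : X → ℝ} (hp : Continuous p)
    (g : X → ℝ) :
    ∫ x, g x ∂(gibbsMeasure eps alpha p) = ∫ x, Real.exp (p x / eps) * g x ∂alpha := by
  have hmeas : Measurable fun x => ENNReal.ofReal (Real.exp (p x / eps)) :=
    (ENNReal.continuous_ofReal.comp (by fun_prop)).measurable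
  rw [gibbsMeasure, integral_withDensity_eq_integral_toReal_smul hmeas
    (ae_of_all _ fun _ => ENNReal.ofReal_lt_top)]
  simp [ENNReal.toReal_ofReal (Real.exp_pos _).le]

theorem eq_of_gibbsMeasure_eq (eps : ℝ) {alpha beta : Measure X} {p : X → ℝ}
    (hp : Continuous p) (h : gibbsMeasure eps alpha p = gibbsMeasure eps beta p) :
    alpha = beta := by
  have hmeas : Measurable fun x => ENNReal.ofReal (Real.exp (p x / eps)) :=
    (ENNReal.continuous_ofReal.comp (by fun_prop)).measurable
  have key (mu : Measure X) : (gibbsMeasure eps mu p).withDensity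
      (fun x => ENNReal.ofReal (Real.exp (p x / eps)))⁻¹ = mu :=
    withDensity_inv_same hmeas
      (ae_of_all _ fun _ => (ENNReal.ofReal_pos.2 (Real.exp_pos _)).ne')
      (ae_of_all _ fun _ => ENNReal.ofReal_ne_top)
  rw [← key alpha, h, key]

variable [CompactSpace X]

theorem integrable_of_continuous_compactSpace {f : X → ℝ} (hf : Continuous f)
    (mu : Measure X) [IsFiniteMeasure mu] : Integrable f mu :=
  hf.integrable_of_hasCompactSupport (HasCompactSupport.of_compactSpace f)

theorem isFiniteMeasure_gibbsMeasure (eps : ℝ) (alpha : Measure X) [IsFiniteMeasure alpha]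
    {p : X → ℝ} (hp : Continuous p) : IsFiniteMeasure (gibbsMeasure eps alpha p) :=
  isFiniteMeasure_withDensity_ofReal
    (integrable_of_continuous_compactSpace (by fun_prop) alpha).hasFiniteIntegral

/-- The potential of the Gibbs measure of a fixed point `p` of the Sinkhorn map is
`exp (-p / ε)`. -/
theorem integral_kernel_gibbsMeasure {eps : ℝ} (heps : 0 < eps) {C : X → X → ℝ}
    (hCsym : ∀ x y, C x y = C y x) (hC : ∀ y, Continuous fun x => C x y)
    (alpha : Measure X) [IsProbabilityMeasure alpha] {p : X → ℝ} (hp : Continuous p)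
    (hfix : p = Tmap eps C alpha p) (x : X) :
    ∫ y, Real.exp (-(C x y) / eps) ∂(gibbsMeasure eps alpha p) = Real.exp (-(p x / eps)) := by
  have hpos : 0 < ∫ y, Real.exp ((p y - C y x) / eps) ∂alpha := by
    have := hC x
    exact integral_exp_pos (integrable_of_continuous_compactSpace (by fun_prop) alpha)
  have hx : p x = -eps * Real.log (∫ y, Real.exp ((p y - C y x) / eps) ∂alpha) :=
    congrFun hfix x
  have hlog : -(p x / eps) = Real.log (∫ y, Real.exp ((p y - C y x) / eps) ∂alpha) := by
    rw [hx]
    field_simp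
  rw [hlog, Real.exp_log hpos, integral_gibbsMeasure eps alpha hp]
  refine integral_congr_ae (ae_of_all _ fun y => ?_)
  simp only [← Real.exp_add, hCsym x y]
  congr 1
  ring

theorem integral_div_add_one_le_integral_exp (eps : ℝ) (mu : Measure X)
    [IsProbabilityMeasure mu] {f : X → ℝ} (hf : Continuous f) :
    (∫ x, f x ∂mu) / eps + 1 ≤ ∫ x, Real.exp (f x / eps) ∂mu := by
  have hint : Integrable (fun x => f x / eps) mu :=
    integrable_of_continuous_compactSpace (by fun_prop) mu
  calc (∫ x, f x ∂mu) / eps + 1 = ∫ x, (f x / eps + 1) ∂mu := by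
        rw [integral_add hint (integrable_const _), integral_div]
        simp
    _ ≤ ∫ x, Real.exp (f x / eps) ∂mu :=
        integral_mono (hint.add (integrable_const _))
          (integrable_of_continuous_compactSpace (by fun_prop) mu)
          fun x => Real.add_one_le_exp _

theorem kerQuad_gibbsMeasure {eps : ℝ} (heps : 0 < eps) {C : X → X → ℝ}
    (hCsym : ∀ x y, C x y = C y x) (hC : ∀ y, Continuous fun x => C x y)
    (alpha beta : Measure X) [IsProbabilityMeasure alpha] [IsProbabilityMeasure beta]
    {pa pb : X → ℝ} (hpa : Continuous pa) (hpb : Continuous pb)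
    (hfixa : pa = Tmap eps C alpha pa) (hfixb : pb = Tmap eps C beta pb) :
    kerQuad (fun x y => Real.exp (-(C x y) / eps))
        (gibbsMeasure eps alpha pa) (gibbsMeasure eps beta pb) =
      2 - ∫ x, Real.exp ((pa x - pb x) / eps) ∂alpha
        - ∫ x, Real.exp ((pb x - pa x) / eps) ∂beta := by
  simp only [kerQuad, integral_kernel_gibbsMeasure heps hCsym hC alpha hpa hfixa,
    integral_kernel_gibbsMeasure heps hCsym hC beta hpb hfixb,
    integral_gibbsMeasure eps alpha hpa, integral_gibbsMeasure eps beta hpb,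
    ← Real.exp_add, ← sub_eq_add_neg, sub_self, Real.exp_zero, ← sub_div]
  simp only [integral_const, probReal_univ, one_smul]
  ring

/-- The Hausdorff divergence dominates the squared kernel norm of the difference of the
Gibbs measures. -/
theorem kerQuad_gibbsMeasure_le {eps : ℝ} (heps : 0 < eps) {C : X → X → ℝ}
    (hCsym : ∀ x y, C x y = C y x) (hC : ∀ y, Continuous fun x => C x y)
    (alpha beta : Measure X) [IsProbabilityMeasure alpha] [IsProbabilityMeasure beta]
    {pa pb : X → ℝ} (hpa : Continuous pa) (hpb : Continuous pb)
    (hfixa : pa = Tmap eps C alpha pa) (hfixb : pb = Tmap eps C beta pb) :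
    eps / 2 * kerQuad (fun x y => Real.exp (-(C x y) / eps))
        (gibbsMeasure eps alpha pa) (gibbsMeasure eps beta pb) ≤
      (1/2) * ((∫ x, (pb x - pa x) ∂alpha) - ∫ x, (pb x - pa x) ∂beta) := by
  have h₁ := integral_div_add_one_le_integral_exp eps alpha
    (f := fun x => pa x - pb x) (hpa.sub hpb)
  have h₂ := integral_div_add_one_le_integral_exp eps beta
    (f := fun x => pb x - pa x) (hpb.sub hpa)
  have hneg : ∫ x, (pa x - pb x) ∂alpha = -∫ x, (pb x - pa x) ∂alpha := by
    rw [← integral_neg]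
    simp only [neg_sub]
  rw [hneg] at h₁
  rw [kerQuad_gibbsMeasure heps hCsym hC alpha beta hpa hpb hfixa hfixb]
  calc _ ≤ eps / 2 * ((∫ x, (pb x - pa x) ∂alpha) / eps
        - (∫ x, (pb x - pa x) ∂beta) / eps) := by
        refine mul_le_mul_of_nonneg_left ?_ (by positivity)
        rw [neg_div] at h₁
        linarith
    _ = _ := by field_simp

end

/-- The Hausdorff divergence
`H_ε(α, β) = ½ ∫ (p_β - p_α) d(α - β)`, built from the symmetric potentials
`p_α = T_ε(α, p_α)` and `p_β = T_ε(β, p_β)`, is nonnegative, and vanishes if and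
only if `α = β`. -/
theorem hausdorff_divergence_nonneg_and_definite
    {X : Type*} [MetricSpace X] [CompactSpace X] [MeasurableSpace X] [BorelSpace X]
    (eps : ℝ) (heps : 0 < eps) (C : X → X → ℝ) (kappa : ℝ≥0) (hkappa : 0 < kappa)
    (hCsym : ∀ x y, C x y = C y x)
    (hClip1 : ∀ y, LipschitzWith kappa (fun x => C x y))
    (hClip2 : ∀ x, LipschitzWith kappa (fun y => C x y))
    (hpd : StrictPosDef (fun x y => Real.exp (-(C x y) / eps)))
    (alpha beta : Measure X) [IsProbabilityMeasure alpha] [IsProbabilityMeasure beta]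
    (pa pb : X → ℝ) (hpa : Continuous pa) (hpb : Continuous pb)
    (hfixa : pa = Tmap eps C alpha pa) (hfixb : pb = Tmap eps C beta pb) :
    0 ≤ (1/2) * ((∫ x, (pb x - pa x) ∂alpha) - ∫ x, (pb x - pa x) ∂beta) ∧
    ((1/2) * ((∫ x, (pb x - pa x) ∂alpha) - ∫ x, (pb x - pa x) ∂beta) = 0
      ↔ alpha = beta) := by
  have hC : ∀ y, Continuous fun x => C x y := fun y => (hClip1 y).continuous
  have hle := kerQuad_gibbsMeasure_le heps hCsym hC alpha beta hpa hpb hfixa hfixb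
  have hdef : alpha ≠ beta →
      0 < (1/2) * ((∫ x, (pb x - pa x) ∂alpha) - ∫ x, (pb x - pa x) ∂beta) := by
    intro hne
    refine lt_of_lt_of_le (mul_pos (half_pos heps) (hpd _ _
      (isFiniteMeasure_gibbsMeasure eps alpha hpa)
      (isFiniteMeasure_gibbsMeasure eps beta hpb) fun heq => hne ?_)) hle
    have hp : pa = pb := by
      funext x
      have hx := integral_kernel_gibbsMeasure heps hCsym hC alpha hpa hfixa x
      rw [heq, integral_kernel_gibbsMeasure heps hCsym hC beta hpb hfixb x,
        Real.exp_eq_exp, neg_inj, div_left_inj' heps.ne'] at hx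
      exact hx.symm
    subst hp
    exact eq_of_gibbsMeasure_eq eps hpa heq
  have hzero : alpha = beta →
      (1/2) * ((∫ x, (pb x - pa x) ∂alpha) - ∫ x, (pb x - pa x) ∂beta) = 0 := by
    rintro rfl
    simp
  refine ⟨?_, fun h => ?_, hzero⟩
  · by_cases h : alpha = beta
    · exact (hzero h).ge
    · exact (hdef h).le
  · by_contra hne
    exact (hdef hne).ne' h
end

section
/- For all finite Borel measures α, β on a compact metric space X, the Kullback–Leibler divergence admits the dual representation KL(α, β) = sup over bounded Borel-measurable functions h : X → ℝ of ∫ h dα − ∫ (e^h − 1) dβ. -/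
open MeasureTheory Real Filter Topology
open scoped NNReal ENNReal

open scoped Classical in
/-- The Kullback-Leibler divergence `KL(α, β) = ∫ log(dα/dβ) dα - α(X) + β(X)`
if `α ≪ β` (and the log-density is `α`-integrable; since the negative part of
the relevant integrand is always integrable for finite measures, the
non-integrable case corresponds to the value `+∞`), and `+∞` otherwise. -/
noncomputable def KLdiv {X : Type*} [MeasurableSpace X] (alpha beta : Measure X) : EReal :=
  if alpha ≪ beta ∧ Integrable (fun x => Real.log ((alpha.rnDeriv beta x).toReal)) alpha then
    (((∫ x, Real.log ((alpha.rnDeriv beta x).toReal) ∂alpha)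
      - (alpha Set.univ).toReal + (beta Set.univ).toReal : ℝ) : EReal)
  else ⊤

/-- The clamp of `log x` to `[-n, n]`, with the convention `log 0 = -∞`. -/
noncomputable def clampLog (n : ℕ) (x : ℝ) : ℝ :=
  if x = 0 then -(n : ℝ) else max (-(n : ℝ)) (min n (Real.log x))

theorem measurable_clampLog (n : ℕ) : Measurable (clampLog n) :=
  Measurable.ite (measurableSet_singleton 0) measurable_const
    (measurable_const.max (measurable_const.min Real.measurable_log))

theorem abs_clampLog_le (n : ℕ) (x : ℝ) : |clampLog n x| ≤ n := by
  have hn : (0 : ℝ) ≤ n := Nat.cast_nonneg n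
  unfold clampLog
  split_ifs
  · simp
  · exact abs_le.2 ⟨le_max_left _ _, max_le (by linarith) (min_le_left _ _)⟩

theorem mul_clampLog_sub_exp_nonneg (n : ℕ) {x : ℝ} (hx : 0 ≤ x) :
    0 ≤ x * clampLog n x - (Real.exp (clampLog n x) - 1) := by
  have hn : (0 : ℝ) ≤ n := Nat.cast_nonneg n
  rcases hx.eq_or_lt with rfl | hx
  · simp [clampLog]
  set h := clampLog n x with hh
  rw [clampLog, if_neg hx.ne'] at hh
  have key : Real.exp h - 1 ≤ Real.exp h * h := by
    have h1 := Real.add_one_le_exp (-h)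
    have h2 : Real.exp h * Real.exp (-h) = 1 := by rw [← Real.exp_add]; simp
    nlinarith [Real.exp_pos h]
  have hmul : Real.exp h * h ≤ x * h := by
    rcases le_total 0 (Real.log x) with hl | hl
    · have h0 : 0 ≤ h := hh ▸ le_max_of_le_right (le_min hn hl)
      have h1 : h ≤ Real.log x := hh ▸ max_le (by linarith) (min_le_right _ _)
      exact mul_le_mul_of_nonneg_right ((Real.le_log_iff_exp_le hx).1 h1) h0
    · have h0 : h ≤ 0 := hh ▸ max_le (by linarith) ((min_le_right _ _).trans hl)
      have h1 : Real.log x ≤ h := hh ▸ le_max_of_le_right (le_min (hl.trans hn) le_rfl)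
      exact mul_le_mul_of_nonpos_right ((Real.log_le_iff_le_exp hx).1 h1) h0
  linarith

theorem tendsto_mul_clampLog_sub_exp {x : ℝ} (hx : 0 ≤ x) :
    Tendsto (fun n : ℕ => x * clampLog n x - (Real.exp (clampLog n x) - 1)) atTop
      (𝓝 (InformationTheory.klFun x)) := by
  rcases hx.eq_or_lt with rfl | hx
  · have h : Tendsto (fun n : ℕ => Real.exp (-(n : ℝ))) atTop (𝓝 0) :=
      Real.tendsto_exp_neg_atTop_nhds_zero.comp tendsto_natCast_atTop_atTop
    simpa [clampLog, InformationTheory.klFun] using h.const_sub 1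
  · obtain ⟨N, hN⟩ := exists_nat_ge |Real.log x|
    refine tendsto_const_nhds.congr' ?_
    filter_upwards [eventually_ge_atTop N] with n hn
    have hle : |Real.log x| ≤ n := hN.trans (Nat.cast_le.2 hn)
    obtain ⟨h1, h2⟩ := abs_le.1 hle
    rw [clampLog, if_neg hx.ne', min_eq_right h2, max_eq_right h1, Real.exp_log hx,
      InformationTheory.klFun]
    ring

/-- Fenchel–Young inequality for the pair `klFun`, `exp - 1`. -/
theorem mul_sub_exp_le_klFun {x : ℝ} (hx : 0 ≤ x) (h : ℝ) :
    x * h - (Real.exp h - 1) ≤ InformationTheory.klFun x := by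
  rw [InformationTheory.klFun]
  rcases hx.eq_or_lt with rfl | hx
  · simpa using (Real.exp_pos h).le
  have h1 := Real.add_one_le_exp (h - Real.log x)
  rw [Real.exp_sub, Real.exp_log hx, le_div_iff₀ hx] at h1
  linarith

section Measure

variable {X : Type*} [MeasurableSpace X] (α β : Measure X) [IsFiniteMeasure α] [IsFiniteMeasure β]

theorem KLdiv_eq_klDiv : KLdiv α β = (InformationTheory.klDiv α β : EReal) := by
  unfold KLdiv
  split_ifs with h
  · have h0 := InformationTheory.integral_llr_add_sub_measure_univ_nonneg h.1 h.2
    rw [InformationTheory.klDiv_of_ac_of_integrable h.1 h.2, EReal.coe_ennreal_ofReal,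
      max_eq_left h0]
    simp only [llr_def, Measure.real]
    congr 1
    ring
  · rw [InformationTheory.klDiv_eq_top_iff.2 fun h1 h2 => h ⟨h1, h2⟩, EReal.coe_ennreal_top]

variable {α β}

theorem integrable_of_measurable_of_abs_le {h : X → ℝ} (hm : Measurable h) {M : ℝ}
    (hM : ∀ x, |h x| ≤ M) : Integrable h α :=
  Integrable.of_bound hm.aestronglyMeasurable M (.of_forall hM)

theorem integrable_exp_sub_one {h : X → ℝ} (hm : Measurable h) {M : ℝ}
    (hM : ∀ x, |h x| ≤ M) : Integrable (fun x => Real.exp (h x) - 1) β :=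
  (integrable_of_measurable_of_abs_le (M := Real.exp M) (Real.measurable_exp.comp hm) fun x => by
    simpa using (le_abs_self _).trans (hM x)).sub (integrable_const 1)

theorem integrable_rnDeriv_mul (hac : α ≪ β) {h : X → ℝ} (hm : Measurable h) {M : ℝ}
    (hM : ∀ x, |h x| ≤ M) : Integrable (fun x => (α.rnDeriv β x).toReal * h x) β :=
  (integrable_rnDeriv_smul_iff hac).2 (integrable_of_measurable_of_abs_le hm hM)

theorem integral_sub_integral_exp_eq (hac : α ≪ β) {h : X → ℝ} (hm : Measurable h) {M : ℝ}
    (hM : ∀ x, |h x| ≤ M) :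
    (∫ x, h x ∂α) - ∫ x, (Real.exp (h x) - 1) ∂β =
      ∫ x, ((α.rnDeriv β x).toReal * h x - (Real.exp (h x) - 1)) ∂β := by
  rw [integral_sub (integrable_rnDeriv_mul hac hm hM) (integrable_exp_sub_one hm hM),
    ← integral_rnDeriv_smul hac]
  rfl

theorem integral_sub_integral_exp_le_klDiv {h : X → ℝ} (hm : Measurable h) {M : ℝ}
    (hM : ∀ x, |h x| ≤ M) :
    (((∫ x, h x ∂α) - ∫ x, (Real.exp (h x) - 1) ∂β : ℝ) : EReal) ≤
      InformationTheory.klDiv α β := by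
  by_cases htop : InformationTheory.klDiv α β = ⊤
  · simp [htop]
  obtain ⟨hac, h_int⟩ := InformationTheory.klDiv_ne_top_iff.1 htop
  rw [← EReal.coe_toReal (x := (InformationTheory.klDiv α β : EReal)) (by simpa using htop)
    (EReal.coe_ennreal_ne_bot _), EReal.coe_le_coe_iff, EReal.toReal_coe_ennreal,
    InformationTheory.toReal_klDiv_eq_integral_klFun hac, integral_sub_integral_exp_eq hac hm hM]
  exact integral_mono ((integrable_rnDeriv_mul hac hm hM).sub (integrable_exp_sub_one hm hM))
    ((InformationTheory.integrable_klFun_rnDeriv_iff hac).2 h_int)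
    fun x => mul_sub_exp_le_klFun ENNReal.toReal_nonneg _

theorem klDiv_le_of_forall_clampLog_le (hac : α ≪ β) {c : ℝ≥0∞}
    (hc : ∀ n : ℕ, ENNReal.ofReal ((∫ x, clampLog n (α.rnDeriv β x).toReal ∂α) -
      ∫ x, (Real.exp (clampLog n (α.rnDeriv β x).toReal) - 1) ∂β) ≤ c) :
    InformationTheory.klDiv α β ≤ c := by
  have hm (n : ℕ) : Measurable fun x => clampLog n (α.rnDeriv β x).toReal :=
    (measurable_clampLog n).comp (Measure.measurable_rnDeriv α β).ennreal_toReal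
  rw [InformationTheory.klDiv_eq_lintegral_klFun_of_ac hac]
  calc ∫⁻ x, ENNReal.ofReal (InformationTheory.klFun (α.rnDeriv β x).toReal) ∂β
    _ = ∫⁻ x, liminf (fun n : ℕ => ENNReal.ofReal ((α.rnDeriv β x).toReal *
          clampLog n (α.rnDeriv β x).toReal -
          (Real.exp (clampLog n (α.rnDeriv β x).toReal) - 1))) atTop ∂β :=
        lintegral_congr fun x =>
          (ENNReal.tendsto_ofReal (tendsto_mul_clampLog_sub_exp ENNReal.toReal_nonneg)).liminf_eq.symm
    _ ≤ liminf (fun n : ℕ => ∫⁻ x, ENNReal.ofReal ((α.rnDeriv β x).toReal *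
          clampLog n (α.rnDeriv β x).toReal -
          (Real.exp (clampLog n (α.rnDeriv β x).toReal) - 1)) ∂β) atTop :=
        lintegral_liminf_le fun n => ENNReal.measurable_ofReal.comp
          (((Measure.measurable_rnDeriv α β).ennreal_toReal.mul (hm n)).sub
            ((Real.measurable_exp.comp (hm n)).sub_const 1))
    _ ≤ c := by
        refine liminf_le_of_le (by isBoundedDefault) fun b hb => ?_
        obtain ⟨n, hn⟩ := hb.exists
        refine hn.trans (le_trans (le_of_eq ?_) (hc n))
        rw [integral_sub_integral_exp_eq hac (hm n) fun x => abs_clampLog_le n _]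
        exact (ofReal_integral_eq_lintegral_ofReal
            ((integrable_rnDeriv_mul hac (hm n) fun x => abs_clampLog_le n _).sub
              (integrable_exp_sub_one (hm n) fun x => abs_clampLog_le n _))
            (.of_forall fun x => mul_clampLog_sub_exp_nonneg n ENNReal.toReal_nonneg)).symm

end Measure

/-- Dual representation of the Kullback-Leibler divergence over
bounded Borel-measurable test functions. -/
theorem KLdiv_dual_measurable
    {X : Type*} [MetricSpace X] [CompactSpace X] [MeasurableSpace X] [BorelSpace X]
    (alpha beta : Measure X) [IsFiniteMeasure alpha] [IsFiniteMeasure beta] :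
    KLdiv alpha beta =
      sSup {r : EReal | ∃ h : X → ℝ, Measurable h ∧ (∃ M : ℝ, ∀ x, |h x| ≤ M) ∧
        r = (((∫ x, h x ∂alpha) - ∫ x, (Real.exp (h x) - 1) ∂beta : ℝ) : EReal)} := by
  rw [KLdiv_eq_klDiv]
  set S := {r : EReal | ∃ h : X → ℝ, Measurable h ∧ (∃ M : ℝ, ∀ x, |h x| ≤ M) ∧
    r = (((∫ x, h x ∂alpha) - ∫ x, (Real.exp (h x) - 1) ∂beta : ℝ) : EReal)}
  refine le_antisymm ?_ (sSup_le ?_)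
  · have h0 : (0 : EReal) ≤ sSup S :=
      le_sSup ⟨fun _ => 0, measurable_const, ⟨0, by simp⟩, by simp⟩
    by_cases hac : alpha ≪ beta
    · rw [← EReal.coe_toENNReal h0, EReal.coe_ennreal_le_coe_ennreal_iff]
      refine klDiv_le_of_forall_clampLog_le hac fun n => ?_
      rw [← EReal.toReal_coe (_ - _), ← EReal.toENNReal_of_ne_top (EReal.coe_ne_top _)]
      exact EReal.toENNReal_le_toENNReal (le_sSup ⟨_, (measurable_clampLog n).comp
        (Measure.measurable_rnDeriv alpha beta).ennreal_toReal,
        ⟨n, fun x => abs_clampLog_le n _⟩, rfl⟩)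
    · suffices sSup S = ⊤ by rw [this]; exact le_top
      obtain ⟨A, hA, hβ, hα⟩ : ∃ A, MeasurableSet A ∧ beta A = 0 ∧ alpha A ≠ 0 := by
        by_contra! H
        exact hac (Measure.AbsolutelyContinuous.mk fun s hs h => H s hs h)
      have hpos : 0 < alpha.real A := ENNReal.toReal_pos hα (measure_ne_top _ _)
      refine EReal.eq_top_iff_forall_lt _ |>.2 fun y => ?_
      obtain ⟨n, hn⟩ := exists_nat_gt (y / alpha.real A)
      rw [div_lt_iff₀ hpos] at hn
      refine lt_of_lt_of_le (EReal.coe_lt_coe_iff.2 hn) (le_sSup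
        ⟨A.indicator fun _ => (n : ℝ), measurable_const.indicator hA, ⟨n, fun x => ?_⟩, ?_⟩)
      · by_cases hx : x ∈ A <;> simp [hx]
      · have hz : ∫ x, (Real.exp (A.indicator (fun _ => (n : ℝ)) x) - 1) ∂beta = 0 := by
          refine integral_eq_zero_of_ae ?_
          filter_upwards [measure_eq_zero_iff_ae_notMem.1 hβ] with x hx
          simp [hx]
        rw [hz, integral_indicator_const _ hA, sub_zero, smul_eq_mul, mul_comm]
  · rintro r ⟨h, hm, ⟨M, hM⟩, rfl⟩
    exact integral_sub_integral_exp_le_klDiv hm hM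
end

section
/- The Kullback–Leibler divergence is jointly lower semicontinuous for the convergence in law: if α_n ⇀ α and β_n ⇀ β are weakly converging sequences of finite Borel measures on a compact metric space X, then liminf_{n→∞} KL(α_n, β_n) ≥ KL(α, β). -/
open MeasureTheory Real Filter Topology
open scoped NNReal ENNReal

open InformationTheory

theorem KLdiv_eq_coe_klDiv {X : Type*} [MeasurableSpace X] (μ ν : Measure X)
    [IsFiniteMeasure μ] [IsFiniteMeasure ν] : KLdiv μ ν = (klDiv μ ν : EReal) := by
  by_cases h : μ ≪ ν ∧ Integrable (fun x => Real.log ((μ.rnDeriv ν x).toReal)) μ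
  · rw [KLdiv, if_pos h, klDiv_of_ac_of_integrable h.1 h.2, EReal.coe_ennreal_ofReal,
      max_eq_left (integral_llr_add_sub_measure_univ_nonneg h.1 h.2), EReal.coe_eq_coe_iff]
    simp only [llr, Measure.real]
    ring
  · rw [KLdiv, if_neg h, klDiv_eq_top_iff.2 fun h1 h2 => h ⟨h1, h2⟩, EReal.coe_ennreal_top]

/-- The functional whose supremum over continuous `f` is the Kullback-Leibler divergence. -/
noncomputable def klDual {X : Type*} [MeasurableSpace X] (μ ν : Measure X) (f : X → ℝ) : ℝ :=
  ∫ x, f x ∂μ - ∫ x, (Real.exp (f x) - 1) ∂ν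

section Bounded

variable {X : Type*} [MeasurableSpace X] {μ ν : Measure X} {f : X → ℝ} {K : ℝ}

theorem Measurable.integrable_of_abs_le [IsFiniteMeasure μ] (hf : Measurable f)
    (hK : ∀ x, |f x| ≤ K) : Integrable f μ :=
  Integrable.of_bound hf.aestronglyMeasurable K (ae_of_all _ hK)

theorem Measurable.integrable_exp_sub_one_of_abs_le [IsFiniteMeasure ν] (hf : Measurable f)
    (hK : ∀ x, |f x| ≤ K) : Integrable (fun x => Real.exp (f x) - 1) ν := by
  refine Integrable.sub (Integrable.of_bound (by fun_prop) (Real.exp K) (ae_of_all _ fun x => ?_))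
    (integrable_const 1)
  rw [Real.norm_eq_abs, abs_of_pos (Real.exp_pos _)]
  exact Real.exp_le_exp.2 (le_of_abs_le (hK x))

theorem integrable_rnDeriv_mul_sub_exp [IsFiniteMeasure μ] [IsFiniteMeasure ν] (h : μ ≪ ν)
    (hf : Measurable f) (hK : ∀ x, |f x| ≤ K) :
    Integrable (fun x => (μ.rnDeriv ν x).toReal * f x - (Real.exp (f x) - 1)) ν :=
  ((integrable_rnDeriv_smul_iff h).2 (hf.integrable_of_abs_le hK)).sub
    (hf.integrable_exp_sub_one_of_abs_le hK)

theorem klDual_eq_integral_rnDeriv [IsFiniteMeasure μ] [IsFiniteMeasure ν] (h : μ ≪ ν)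
    (hf : Measurable f) (hK : ∀ x, |f x| ≤ K) :
    klDual μ ν f = ∫ x, ((μ.rnDeriv ν x).toReal * f x - (Real.exp (f x) - 1)) ∂ν := by
  have hint : Integrable (fun x => (μ.rnDeriv ν x).toReal * f x) ν :=
    (integrable_rnDeriv_smul_iff h).2 (hf.integrable_of_abs_le hK)
  rw [integral_sub hint (hf.integrable_exp_sub_one_of_abs_le hK), klDual,
    ← integral_rnDeriv_smul h]
  rfl

theorem mul_sub_exp_le_klFun_s17 {r : ℝ} (hr : 0 ≤ r) (t : ℝ) :
    r * t - (Real.exp t - 1) ≤ klFun r := by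
  rw [klFun_apply]
  rcases hr.eq_or_lt with rfl | hr
  · simp only [zero_mul]
    linarith [Real.exp_pos t]
  · have h1 := Real.add_one_le_exp (t - Real.log r)
    rw [Real.exp_sub, Real.exp_log hr, le_div_iff₀ hr] at h1
    nlinarith

/-- Gibbs variational inequality: `klDual μ ν f` is at most the divergence. -/
theorem ofReal_klDual_le_klDiv [IsFiniteMeasure μ] [IsFiniteMeasure ν]
    (hf : Measurable f) (hK : ∀ x, |f x| ≤ K) :
    ENNReal.ofReal (klDual μ ν f) ≤ klDiv μ ν := by
  by_cases htop : klDiv μ ν = ∞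
  · simp [htop]
  obtain ⟨hac, hint⟩ := klDiv_ne_top_iff.1 htop
  refine ENNReal.ofReal_le_of_le_toReal ?_
  rw [klDual_eq_integral_rnDeriv hac hf hK, toReal_klDiv_eq_integral_klFun hac]
  exact integral_mono (integrable_rnDeriv_mul_sub_exp hac hf hK)
    ((integrable_klFun_rnDeriv_iff hac).2 hint)
    fun x => mul_sub_exp_le_klFun_s17 ENNReal.toReal_nonneg _

end Bounded

theorem abs_exp_sub_exp_le {a b K : ℝ} (ha : a ≤ K) (hb : b ≤ K) :
    |Real.exp a - Real.exp b| ≤ Real.exp K * |a - b| := by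
  wlog hab : b ≤ a generalizing a b
  · rw [abs_sub_comm, abs_sub_comm a]
    exact this hb ha (le_of_not_ge hab)
  rw [abs_of_nonneg (sub_nonneg.2 (Real.exp_le_exp.2 hab)), abs_of_nonneg (sub_nonneg.2 hab)]
  have h1 := Real.add_one_le_exp (b - a)
  have h2 : Real.exp b = Real.exp a * Real.exp (b - a) := by rw [← Real.exp_add]; ring_nf
  calc Real.exp a - Real.exp b = Real.exp a * (1 - Real.exp (b - a)) := by rw [h2]; ring
    _ ≤ Real.exp a * (a - b) := mul_le_mul_of_nonneg_left (by linarith) (Real.exp_pos a).le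
    _ ≤ Real.exp K * (a - b) := by
      have := sub_nonneg.2 hab
      gcongr

theorem abs_clamp_sub_le {K a b : ℝ} (ha : |a| ≤ K) :
    |a - max (-K) (min K b)| ≤ |a - b| := by
  obtain ⟨h1, h2⟩ := abs_le.1 ha
  rcases le_total K b with h | h
  · rw [min_eq_left h, max_eq_right (by linarith), abs_of_nonpos (by linarith),
      abs_of_nonpos (by linarith)]
    linarith
  · rw [min_eq_right h]
    rcases le_total b (-K) with h' | h'
    · rw [max_eq_left h', abs_of_nonneg (by linarith), abs_of_nonneg (by linarith)]
      linarith
    · rw [max_eq_right h']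

section Approximation

variable {X : Type*} [PseudoMetricSpace X] [MeasurableSpace X] [BorelSpace X]
  {μ ν : Measure X} [IsFiniteMeasure μ] [IsFiniteMeasure ν] {g : X → ℝ} {K : ℝ}

theorem exists_continuous_lt_klDual (hg : Measurable g) (hK : ∀ x, |g x| ≤ K) {z : ℝ}
    (hz : z < klDual μ ν g) :
    ∃ f : X → ℝ, Continuous f ∧ (∀ x, |f x| ≤ |K|) ∧ z < klDual μ ν f := by
  rcases isEmpty_or_nonempty X with hX | ⟨⟨x₀⟩⟩
  · exact ⟨g, continuous_of_const fun x => hX.elim x, fun x => hX.elim x, hz⟩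
  have hK0 : 0 ≤ K := (abs_nonneg _).trans (hK x₀)
  set C := 1 + Real.exp K with hC
  have hCpos : 0 < C := by positivity
  set ε := (klDual μ ν g - z) / (2 * C) with hε
  have hεpos : 0 < ε := div_pos (sub_pos.2 hz) (by positivity)
  obtain ⟨f₀, hf₀, -⟩ := (hg.integrable_of_abs_le (μ := μ + ν)
    hK).exists_boundedContinuous_integral_sub_le hεpos
  set f : X → ℝ := fun x => max (-K) (min K (f₀ x)) with hf
  have hfc : Continuous f := by fun_prop
  have hfK : ∀ x, |f x| ≤ K := fun x =>
    abs_le.2 ⟨le_max_left _ _, max_le (by linarith) (min_le_left _ _)⟩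
  have hd : ∀ (ρ : Measure X) [IsFiniteMeasure ρ], Integrable (fun x => |g x - f x|) ρ :=
    fun ρ _ => ((hg.integrable_of_abs_le hK).sub (hfc.measurable.integrable_of_abs_le hfK)).abs
  have hle : ∫ x, |g x - f x| ∂(μ + ν) ≤ ε := by
    refine le_trans (integral_mono (hd _) ?_ fun x => abs_clamp_sub_le (hK x)) hf₀
    exact ((hg.integrable_of_abs_le hK).sub (f₀.integrable _)).norm
  rw [integral_add_measure (hd μ) (hd ν)] at hle
  have hμ : ∫ x, g x ∂μ - ∫ x, f x ∂μ ≤ ∫ x, |g x - f x| ∂μ := by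
    rw [← integral_sub (hg.integrable_of_abs_le hK) (hfc.measurable.integrable_of_abs_le hfK)]
    exact (le_abs_self _).trans (abs_integral_le_integral_abs)
  have hν : ∫ x, (Real.exp (f x) - 1) ∂ν - ∫ x, (Real.exp (g x) - 1) ∂ν
      ≤ Real.exp K * ∫ x, |g x - f x| ∂ν := by
    have hfi := hfc.measurable.integrable_exp_sub_one_of_abs_le (ν := ν) hfK
    have hgi := hg.integrable_exp_sub_one_of_abs_le (ν := ν) hK
    rw [← integral_sub hfi hgi, ← integral_const_mul]
    refine integral_mono (hfi.sub hgi) ((hd ν).const_mul _) fun x => ?_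
    have := (le_abs_self _).trans
      (abs_exp_sub_exp_le (le_of_abs_le (hfK x)) (le_of_abs_le (hK x)))
    rw [abs_sub_comm] at this
    dsimp only
    linarith
  refine ⟨f, hfc, fun x => (hfK x).trans (le_abs_self K), ?_⟩
  have h1 : 0 ≤ ∫ x, |g x - f x| ∂μ := integral_nonneg fun _ => abs_nonneg _
  have h2 : 0 ≤ ∫ x, |g x - f x| ∂ν := integral_nonneg fun _ => abs_nonneg _
  have h3 : C * ε = (klDual μ ν g - z) / 2 := by rw [hε]; field_simp
  have h4 : klDual μ ν g - klDual μ ν f ≤ C * ε := by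
    have h5 : klDual μ ν g - klDual μ ν f
        ≤ ∫ x, |g x - f x| ∂μ + Real.exp K * ∫ x, |g x - f x| ∂ν := by
      simp only [klDual]
      linarith
    have h6 := mul_le_mul_of_nonneg_left hle hCpos.le
    have h7 := mul_nonneg (Real.exp_pos K).le h1
    rw [hC] at h6 ⊢
    nlinarith
  linarith

theorem ofReal_klDual_le_of_forall_continuous {M : ℝ≥0∞}
    (hM : ∀ f : X → ℝ, Continuous f → (∃ C, ∀ x, |f x| ≤ C) → ENNReal.ofReal (klDual μ ν f) ≤ M)
    (hg : Measurable g) (hK : ∀ x, |g x| ≤ K) : ENNReal.ofReal (klDual μ ν g) ≤ M := by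
  refine le_of_forall_lt fun z hz => ?_
  lift z to ℝ≥0 using hz.ne_top
  have hz' : (z : ℝ) < klDual μ ν g := by
    rw [← ENNReal.ofReal_coe_nnreal] at hz
    exact (ENNReal.ofReal_lt_ofReal_iff_of_nonneg z.2).1 hz
  obtain ⟨f, hfc, hfK, hfz⟩ := exists_continuous_lt_klDual hg hK hz'
  refine lt_of_lt_of_le ?_ (hM f hfc ⟨_, hfK⟩)
  rw [← ENNReal.ofReal_coe_nnreal]
  exact (ENNReal.ofReal_lt_ofReal_iff_of_nonneg z.2).2 hfz

end Approximation

/-- Truncation of `r` to the interval `[1 / (n + 1), n + 1]`. -/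
noncomputable def truncPos (n : ℕ) (r : ℝ) : ℝ := max (1 / (n + 1 : ℝ)) (min (n + 1) r)

theorem truncPos_pos (n : ℕ) (r : ℝ) : 0 < truncPos n r :=
  lt_max_of_lt_left (by positivity)

theorem abs_log_truncPos_le (n : ℕ) (r : ℝ) : |Real.log (truncPos n r)| ≤ Real.log (n + 1) := by
  have h1 : (1 : ℝ) ≤ n + 1 := by simp
  have h2 : 1 / (n + 1 : ℝ) ≤ 1 := by rw [div_le_one (by positivity)]; exact h1
  rw [abs_le]
  constructor
  · rw [← Real.log_inv, ← one_div]
    exact Real.log_le_log (by positivity) (le_max_left _ _)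
  · exact Real.log_le_log (truncPos_pos n r) (max_le (h2.trans h1) (min_le_left _ _))

theorem mul_log_truncPos_sub_nonneg (n : ℕ) (r : ℝ) :
    0 ≤ r * Real.log (truncPos n r) - (truncPos n r - 1) := by
  have hpos := truncPos_pos n r
  have h1 : (1 : ℝ) ≤ n + 1 := by simp
  have h2 : 1 / (n + 1 : ℝ) ≤ 1 := by rw [div_le_one (by positivity)]; exact h1
  have hkl := klFun_nonneg hpos.le
  rw [klFun_apply] at hkl
  suffices 0 ≤ (r - truncPos n r) * Real.log (truncPos n r) by linarith
  rcases le_total (n + 1 : ℝ) r with h | h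
  · have hc : truncPos n r = n + 1 := by
      rw [truncPos, min_eq_left h, max_eq_right (h2.trans h1)]
    rw [hc]
    exact mul_nonneg (sub_nonneg.2 h) (Real.log_nonneg h1)
  · rcases le_total r (1 / (n + 1 : ℝ)) with h' | h'
    · have hc : truncPos n r = 1 / (n + 1) := by
        rw [truncPos, min_eq_right h, max_eq_left h']
      rw [hc]
      exact mul_nonneg_of_nonpos_of_nonpos (sub_nonpos.2 h')
        (Real.log_nonpos (by positivity) h2)
    · have hc : truncPos n r = r := by rw [truncPos, min_eq_right h, max_eq_right h']
      rw [hc]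
      simp

theorem tendsto_mul_log_truncPos_sub {r : ℝ} (hr : 0 ≤ r) :
    Tendsto (fun n : ℕ => r * Real.log (truncPos n r) - (truncPos n r - 1)) atTop
      (𝓝 (klFun r)) := by
  have hinv := tendsto_one_div_add_atTop_nhds_zero_nat (𝕜 := ℝ)
  have hlarge : ∀ᶠ n : ℕ in atTop, r ≤ (n : ℝ) + 1 :=
    (tendsto_natCast_atTop_atTop (R := ℝ)).eventually_ge_atTop r |>.mono fun n hn => by linarith
  have hc : Tendsto (fun n : ℕ => truncPos n r) atTop (𝓝 r) := by
    have h := hinv.max (tendsto_const_nhds (x := r))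
    rw [max_eq_right hr] at h
    refine h.congr' (hlarge.mono fun n hn => ?_)
    simp only [truncPos, min_eq_right hn]
  have hl : Tendsto (fun n : ℕ => r * Real.log (truncPos n r)) atTop (𝓝 (r * Real.log r)) := by
    rcases hr.eq_or_lt with rfl | hr
    · simp
    · exact (hc.log hr.ne').const_mul r
  have h := hl.sub (hc.sub_const 1)
  rw [klFun_apply]
  convert h using 2
  ring

section Duality

variable {X : Type*} [MeasurableSpace X] {μ ν : Measure X} [IsFiniteMeasure μ] [IsFiniteMeasure ν]

/-- The divergence is at most the supremum of `klDual` over bounded measurable functions. -/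
theorem klDiv_le_of_forall_bounded_measurable {M : ℝ≥0∞}
    (hM : ∀ (g : X → ℝ) (K : ℝ), Measurable g → (∀ x, |g x| ≤ K) →
      ENNReal.ofReal (klDual μ ν g) ≤ M) :
    klDiv μ ν ≤ M := by
  by_cases hac : μ ≪ ν
  · set r : X → ℝ := fun x => (μ.rnDeriv ν x).toReal with hr
    have hrm : Measurable r := (Measure.measurable_rnDeriv μ ν).ennreal_toReal
    have hcm : ∀ n, Measurable fun x => truncPos n (r x) := fun n => by
      unfold truncPos
      fun_prop
    rw [klDiv_eq_lintegral_klFun_of_ac hac]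
    calc ∫⁻ x, ENNReal.ofReal (klFun (r x)) ∂ν
        = ∫⁻ x, liminf (fun n : ℕ => ENNReal.ofReal
            (r x * Real.log (truncPos n (r x)) - (truncPos n (r x) - 1))) atTop ∂ν := by
          refine lintegral_congr fun x => (Tendsto.liminf_eq ?_).symm
          exact ENNReal.tendsto_ofReal (tendsto_mul_log_truncPos_sub ENNReal.toReal_nonneg)
      _ ≤ liminf (fun n : ℕ => ∫⁻ x, ENNReal.ofReal
            (r x * Real.log (truncPos n (r x)) - (truncPos n (r x) - 1)) ∂ν) atTop :=
          lintegral_liminf_le fun n => by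
            have := hcm n
            fun_prop
      _ ≤ M := by
          refine liminf_le_of_le (by isBoundedDefault) fun b hb => ?_
          obtain ⟨n, hn⟩ := hb.exists
          refine hn.trans ?_
          have hgm := (hcm n).log
          have hgK : ∀ x, |Real.log (truncPos n (r x))| ≤ Real.log (n + 1) :=
            fun x => abs_log_truncPos_le n (r x)
          have hexp : ∀ x, Real.exp (Real.log (truncPos n (r x))) = truncPos n (r x) :=
            fun x => Real.exp_log (truncPos_pos n (r x))
          have hint := integrable_rnDeriv_mul_sub_exp hac hgm hgK
          have hdual := klDual_eq_integral_rnDeriv hac hgm hgK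
          simp only [hexp] at hint hdual
          rw [← ofReal_integral_eq_lintegral_ofReal hint
            (ae_of_all _ fun x => mul_log_truncPos_sub_nonneg n (r x)), ← hdual]
          exact hM _ _ hgm hgK
  · obtain ⟨A, hA, hνA, hμA⟩ : ∃ A, MeasurableSet A ∧ ν A = 0 ∧ μ A ≠ 0 := by
      by_contra! h
      exact hac (Measure.AbsolutelyContinuous.mk h)
    suffices M = ∞ by simp [this]
    have hn : ∀ n : ℕ, ENNReal.ofReal (n * μ.real A) ≤ M := fun n => by
      have hdual : klDual μ ν (A.indicator fun _ => (n : ℝ)) = n * μ.real A := by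
        have h0 : ∫ x, (Real.exp (A.indicator (fun _ => (n : ℝ)) x) - 1) ∂ν = 0 := by
          refine integral_eq_zero_of_ae ?_
          filter_upwards [measure_eq_zero_iff_ae_notMem.1 hνA] with x hx
          simp [hx]
        rw [klDual, h0, integral_indicator_const _ hA, smul_eq_mul, sub_zero, mul_comm]
      rw [← hdual]
      refine hM _ n (measurable_const.indicator hA) fun x => ?_
      by_cases hx : x ∈ A <;> simp [hx]
    have hpos : 0 < μ.real A := ENNReal.toReal_pos hμA (measure_ne_top _ _)
    have hlim : Tendsto (fun n : ℕ => ENNReal.ofReal (n * μ.real A)) atTop (𝓝 ∞) :=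
      ENNReal.tendsto_ofReal_atTop.comp (tendsto_natCast_atTop_atTop.atTop_mul_const hpos)
    exact top_le_iff.1 (le_of_tendsto' hlim hn)

end Duality

/-- The Kullback-Leibler divergence is jointly lower
semicontinuous for the convergence in law. -/
theorem KLdiv_weakly_lsc
    {X : Type*} [MetricSpace X] [CompactSpace X] [MeasurableSpace X] [BorelSpace X]
    (alphaSeq betaSeq : ℕ → Measure X) (alpha beta : Measure X)
    [∀ n, IsFiniteMeasure (alphaSeq n)] [∀ n, IsFiniteMeasure (betaSeq n)]
    [IsFiniteMeasure alpha] [IsFiniteMeasure beta]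
    (halpha : ∀ f : X → ℝ, Continuous f →
      Tendsto (fun n => ∫ x, f x ∂(alphaSeq n)) atTop (𝓝 (∫ x, f x ∂alpha)))
    (hbeta : ∀ f : X → ℝ, Continuous f →
      Tendsto (fun n => ∫ x, f x ∂(betaSeq n)) atTop (𝓝 (∫ x, f x ∂beta))) :
    KLdiv alpha beta ≤ Filter.liminf (fun n => KLdiv (alphaSeq n) (betaSeq n)) atTop := by
  simp only [KLdiv_eq_coe_klDiv]
  have hmono : Monotone ((↑) : ℝ≥0∞ → EReal) := EReal.coe_ennreal_strictMono.monotone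
  have hcoe := hmono.map_liminf_of_continuousAt (F := atTop)
    (fun n => klDiv (alphaSeq n) (betaSeq n)) continuous_coe_ennreal_ereal.continuousAt
  refine le_trans (hmono ?_) hcoe.le
  refine klDiv_le_of_forall_bounded_measurable fun g K hg hK =>
    ofReal_klDual_le_of_forall_continuous (fun f hf ⟨C, hC⟩ => ?_) hg hK
  have htend : Tendsto (fun n => klDual (alphaSeq n) (betaSeq n) f) atTop
      (𝓝 (klDual alpha beta f)) :=
    (halpha f hf).sub (hbeta (fun x => Real.exp (f x) - 1) (by fun_prop))
  rw [← (ENNReal.tendsto_ofReal htend).liminf_eq]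
  exact liminf_le_liminf (Eventually.of_forall fun n =>
    ofReal_klDual_le_klDiv hf.measurable hC)
end

section
/- Let α be a Borel probability measure on a compact metric space X and let φ : X → ℝ be continuous. Then the SoftMin interpolates between a minimum and a mean: as ε → 0⁺, min_{ε, x∼α} φ(x) → min over x in the support of α of φ(x), and as ε → +∞, min_{ε, x∼α} φ(x) → ∫ φ dα. -/
open MeasureTheory Real Filter Topology
open scoped NNReal ENNReal

/-- The SoftMin of strength `ε` of the values of `φ` on `α`:
`min_{ε, x∼α} φ(x) = -ε log ∫ exp(-φ(x)/ε) dα(x)`. -/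
noncomputable def softMin {X : Type*} [MeasurableSpace X] (eps : ℝ) (alpha : Measure X)
    (phi : X → ℝ) : ℝ :=
  -eps * Real.log (∫ x, Real.exp (-phi x / eps) ∂alpha)

/-- The (topological) support of a Borel measure: points all of whose
neighborhoods have positive measure. -/
def msupport {X : Type*} [TopologicalSpace X] [MeasurableSpace X] (alpha : Measure X) :
    Set X :=
  {x : X | ∀ U ∈ 𝓝 x, 0 < alpha U}

theorem msupport_eq_support {X : Type*} [TopologicalSpace X] [MeasurableSpace X]
    (alpha : Measure X) : msupport alpha = alpha.support :=
  Set.ext fun x => (Measure.mem_support_iff_forall x).symm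

theorem integrable_of_continuous_of_compactSpace {X : Type*} [TopologicalSpace X] [CompactSpace X]
    [MeasurableSpace X] [OpensMeasurableSpace X] (alpha : Measure X) [IsFiniteMeasure alpha]
    {f : X → ℝ} (hf : Continuous f) : Integrable f alpha := by
  rw [← integrableOn_univ]
  exact hf.continuousOn.integrableOn_compact' isCompact_univ MeasurableSet.univ

/-- A lower bound on the Gibbs integral gives an upper bound on the SoftMin. -/
theorem softMin_le_of_le_integral {X : Type*} [MeasurableSpace X] {alpha : Measure X}
    {phi : X → ℝ} {eps b c : ℝ} (heps : 0 < eps) (hc : 0 < c)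
    (h : c * exp (-b / eps) ≤ ∫ x, exp (-phi x / eps) ∂alpha) :
    softMin eps alpha phi ≤ b - eps * log c := by
  have h1 := Real.log_le_log (by positivity) h
  rw [Real.log_mul hc.ne' (exp_pos _).ne', Real.log_exp] at h1
  have h2 := mul_le_mul_of_nonneg_left h1 heps.le
  have h3 : eps * (log c + -b / eps) = eps * log c - b := by field_simp; ring
  rw [softMin]
  linarith

/-- If `phi ≥ b` almost everywhere, then the SoftMin is at least `b`. -/
theorem le_softMin_of_ae_le {X : Type*} [MeasurableSpace X] {alpha : Measure X}
    [IsProbabilityMeasure alpha] {phi : X → ℝ} {eps b : ℝ} (heps : 0 < eps)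
    (hint : Integrable (fun x => exp (-phi x / eps)) alpha) (h : ∀ᵐ x ∂alpha, b ≤ phi x) :
    b ≤ softMin eps alpha phi := by
  have h1 : ∫ x, exp (-phi x / eps) ∂alpha ≤ exp (-b / eps) := by
    calc ∫ x, exp (-phi x / eps) ∂alpha ≤ ∫ _, exp (-b / eps) ∂alpha := by
          refine integral_mono_ae hint (integrable_const _) ?_
          filter_upwards [h] with x hx
          gcongr
      _ = exp (-b / eps) := by simp
  have h2 := Real.log_le_log (integral_exp_pos hint) h1
  rw [Real.log_exp] at h2
  have h3 := mul_le_mul_of_nonneg_left h2 heps.le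
  have h4 : eps * (-b / eps) = -b := by field_simp
  rw [softMin]
  linarith

/-- Jensen's inequality for the SoftMin. -/
theorem softMin_le_integral {X : Type*} [MeasurableSpace X] {alpha : Measure X}
    [IsProbabilityMeasure alpha] {phi : X → ℝ} {eps : ℝ} (heps : 0 < eps)
    (hphi : Integrable phi alpha) (hint : Integrable (fun x => exp (-phi x / eps)) alpha) :
    softMin eps alpha phi ≤ ∫ x, phi x ∂alpha := by
  have h := convexOn_exp.map_integral_le (μ := alpha) continuous_exp.continuousOn isClosed_univ
    (by simp) (hphi.neg.div_const eps) hint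
  have h1 := softMin_le_of_le_integral (b := ∫ x, phi x ∂alpha) (c := 1) heps one_pos
    (by simpa [integral_div, integral_neg] using h)
  simpa using h1

/-- A quantitative lower bound on the SoftMin of a bounded function, for large strength. -/
theorem integral_sub_le_softMin {X : Type*} [MeasurableSpace X] {alpha : Measure X}
    [IsProbabilityMeasure alpha] {phi : X → ℝ} {eps M : ℝ} (heps : 0 < eps) (hM : M ≤ eps)
    (hphi : Integrable phi alpha) (hint : Integrable (fun x => exp (-phi x / eps)) alpha)
    (hbound : ∀ x, |phi x| ≤ M) :
    ∫ x, phi x ∂alpha - M ^ 2 / eps ≤ softMin eps alpha phi := by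
  have hpt : ∀ x, exp (-phi x / eps) ≤ (1 + M ^ 2 / eps ^ 2) - phi x / eps := by
    intro x
    have hu : |-phi x / eps| ≤ 1 := by
      rw [abs_div, abs_neg, abs_of_pos heps, div_le_one heps]
      exact (hbound x).trans hM
    have h1 := (abs_le.mp (abs_exp_sub_one_sub_id_le hu)).2
    have h2 : (-phi x / eps) ^ 2 ≤ M ^ 2 / eps ^ 2 := by
      rw [div_pow, neg_sq, ← sq_abs (phi x)]
      gcongr
      exact hbound x
    have h3 : -phi x / eps = -(phi x / eps) := neg_div _ _
    linarith
  have h1 : ∫ x, exp (-phi x / eps) ∂alpha ≤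
      (1 + M ^ 2 / eps ^ 2) - (∫ x, phi x ∂alpha) / eps := by
    refine (integral_mono hint ((integrable_const _).sub (hphi.div_const eps)) hpt).trans_eq ?_
    rw [integral_sub' (integrable_const _) (hphi.div_const eps), integral_div]
    simp
  have h2 := (Real.log_le_sub_one_of_pos (integral_exp_pos hint)).trans (sub_le_sub_right h1 1)
  have h3 := mul_le_mul_of_nonneg_left h2 heps.le
  have h4 : eps * ((1 + M ^ 2 / eps ^ 2) - (∫ x, phi x ∂alpha) / eps - 1) =
      M ^ 2 / eps - ∫ x, phi x ∂alpha := by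
    field_simp; ring
  rw [softMin]
  linarith

/-- The SoftMin interpolates between the minimum over the
support (as `ε → 0⁺`) and the mean (as `ε → +∞`). -/
theorem softMin_interpolates
    {X : Type*} [MetricSpace X] [CompactSpace X] [MeasurableSpace X] [BorelSpace X]
    (alpha : Measure X) [IsProbabilityMeasure alpha]
    (phi : X → ℝ) (hphi : Continuous phi) :
    Tendsto (fun eps => softMin eps alpha phi) (𝓝[>] (0:ℝ))
      (𝓝 (sInf (phi '' msupport alpha))) ∧
    Tendsto (fun eps => softMin eps alpha phi) atTop (𝓝 (∫ x, phi x ∂alpha)) := by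
  have hintphi : Integrable phi alpha := integrable_of_continuous_of_compactSpace alpha hphi
  have hint : ∀ eps : ℝ, Integrable (fun x => exp (-phi x / eps)) alpha := fun eps =>
    integrable_of_continuous_of_compactSpace alpha (by fun_prop)
  constructor
  · rw [msupport_eq_support]
    obtain ⟨x₀, hx₀, hinf, hmin⟩ := Measure.isClosed_support.isCompact.exists_sInf_image_eq_and_le
      (Measure.nonempty_support (IsProbabilityMeasure.ne_zero alpha)) hphi.continuousOn
    rw [hinf]
    have hae : ∀ᵐ x ∂alpha, phi x₀ ≤ phi x := by
      filter_upwards [Measure.support_mem_ae] with x hx using hmin x hx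
    refine tendsto_order.2 ⟨fun a ha => ?_, fun a ha => ?_⟩
    · filter_upwards [self_mem_nhdsWithin] with eps heps
      exact ha.trans_le (le_softMin_of_ae_le heps (hint eps) hae)
    · obtain ⟨b, hb, hba⟩ := exists_between ha
      set U := {x | phi x < b}
      have hU : IsOpen U := isOpen_lt hphi continuous_const
      have hc : 0 < alpha.real U :=
        ENNReal.toReal_pos ((Measure.mem_support_iff_forall x₀).1 hx₀ U (hU.mem_nhds hb)).ne'
          (measure_ne_top _ _)
      have hlim : Tendsto (fun eps : ℝ => b - eps * log (alpha.real U)) (𝓝[>] 0) (𝓝 b) := by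
        have : Continuous fun eps : ℝ => b - eps * log (alpha.real U) := by fun_prop
        simpa using (this.tendsto 0).mono_left nhdsWithin_le_nhds
      filter_upwards [self_mem_nhdsWithin, hlim.eventually_lt_const hba] with eps heps hlt
      have heps : 0 < eps := heps
      refine (softMin_le_of_le_integral heps hc ?_).trans_lt hlt
      calc alpha.real U * exp (-b / eps) = ∫ _ in U, exp (-b / eps) ∂alpha := by simp
        _ ≤ ∫ x in U, exp (-phi x / eps) ∂alpha := by
          refine setIntegral_mono_on (integrable_const _) (hint eps).integrableOn
            hU.measurableSet fun x hx => ?_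
          have hx : phi x < b := hx
          gcongr
        _ ≤ ∫ x, exp (-phi x / eps) ∂alpha :=
          setIntegral_le_integral (hint eps) (ae_of_all _ fun x => (exp_pos _).le)
  · obtain ⟨M, hM⟩ := isCompact_univ.exists_bound_of_continuousOn hphi.continuousOn
    have hlim : Tendsto (fun eps : ℝ => ∫ x, phi x ∂alpha - M ^ 2 / eps) atTop
        (𝓝 (∫ x, phi x ∂alpha)) := by
      simpa using (tendsto_const_nhds (x := ∫ x, phi x ∂alpha)).sub
        ((tendsto_const_nhds (x := M ^ 2)).div_atTop tendsto_id)
    refine tendsto_of_tendsto_of_tendsto_of_le_of_le' hlim tendsto_const_nhds ?_ ?_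
    · filter_upwards [eventually_gt_atTop 0, eventually_ge_atTop M] with eps heps hMe
      exact integral_sub_le_softMin heps hMe hintphi (hint eps) fun x => hM x (Set.mem_univ x)
    · filter_upwards [eventually_gt_atTop 0] with eps heps
      exact softMin_le_integral heps hintphi (hint eps)
end
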